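/- If n = p^α q^β, where p and q are distinct primes and α, β ∈ ℕ, then κ(𝒢(ℤ_n)) = φ(n) + p^{α−1} q^{β−1}. Moreover, if n ≠ pq, then ⟨\overline{pq}⟩ − {0̄} is a minimum separating set of 𝒢̃(ℤ_n). -/

import Mathlib

open SimpleGraph

/-- The power graph of a (multiplicative) group: distinct `x, y` are adjacent
iff one is a power of the other. -/
def powerGraph (G : Type*) [Group G] : SimpleGraph G where
  Adj x y := x ≠ y ∧ (x ∈ Subgroup.zpowers y ∨ y ∈ Subgroup.zpowers x)
  symm := by
    constructor
    rintro x y ⟨h1, h2⟩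
    exact ⟨h1.symm, h2.symm⟩
  loopless := by
    constructor
    rintro x ⟨h1, -⟩
    exact h1 rfl

/-- The power graph of the additive group `ℤ_n`. -/
def powerGraphZ (n : ℕ) : SimpleGraph (ZMod n) where
  Adj x y := x ≠ y ∧ (x ∈ AddSubgroup.zmultiples y ∨ y ∈ AddSubgroup.zmultiples x)
  symm := by
    constructor
    rintro x y ⟨h1, h2⟩
    exact ⟨h1.symm, h2.symm⟩
  loopless := by
    constructor
    rintro x ⟨h1, -⟩
    exact h1 rfl

/-- Number of connected components of a graph. -/
noncomputable def numComponents {V : Type*} (Γ : SimpleGraph V) : ℕ :=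
  Nat.card Γ.ConnectedComponent

/-- `T` is a separating set of `Γ`: deleting `T` increases the number of components. -/
def IsSepSet {V : Type*} (Γ : SimpleGraph V) (T : Set V) : Prop :=
  numComponents Γ < numComponents (Γ.induce Tᶜ)

/-- A separating set is minimal if no nonempty proper subset of it is separating. -/
def IsMinimalSepSet {V : Type*} (Γ : SimpleGraph V) (T : Set V) : Prop :=
  IsSepSet Γ T ∧ ∀ S : Set V, S ⊆ T → S ≠ T → S.Nonempty → ¬ IsSepSet Γ S

/-- A separating set of least cardinality. -/
def IsMinimumSepSet {V : Type*} (Γ : SimpleGraph V) (T : Set V) : Prop :=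
  IsSepSet Γ T ∧ ∀ S : Set V, IsSepSet Γ S → T.ncard ≤ S.ncard

/-- Vertex connectivity: the least number of vertices whose removal leaves a
disconnected or one-vertex graph. -/
noncomputable def kappa {V : Type*} (Γ : SimpleGraph V) : ℕ :=
  sInf {k | ∃ S : Set V, S.ncard = k ∧
    (¬ (Γ.induce Sᶜ).Preconnected ∨ (Sᶜ : Set V).ncard = 1)}

/-- `𝒮(ℤ_n)`: the identity together with the generators of `ℤ_n`. -/
def genSet (n : ℕ) : Set (ZMod n) :=
  {x | AddSubgroup.zmultiples x = ⊤} ∪ {0}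

/-- `ℤ̃_n = ℤ_n − 𝒮(ℤ_n)`. -/
def tildeVerts (n : ℕ) : Set (ZMod n) := (genSet n)ᶜ

/-- `𝒢̃(ℤ_n)`: the subgraph of the power graph induced on `ℤ̃_n`. -/
def tildeGraph (n : ℕ) : SimpleGraph (tildeVerts n) :=
  (powerGraphZ n).induce (tildeVerts n)

/-- The `≈`-class of `x`: elements generating the same cyclic subgroup. -/
def simClass {G : Type*} [Group G] (x : G) : Set G :=
  {y | Subgroup.zpowers y = Subgroup.zpowers x}

/-- The `≈`-class in `ℤ_n`. -/
def simClassZ {n : ℕ} (x : ZMod n) : Set (ZMod n) :=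
  {y | AddSubgroup.zmultiples y = AddSubgroup.zmultiples x}

/-- Neighbourhood of a set of vertices: vertices adjacent to some element of `A`,
excluding `A` itself. -/
def setNbhd {V : Type*} (Γ : SimpleGraph V) (A : Set V) : Set V :=
  (⋃ a ∈ A, Γ.neighborSet a) \ A

/-- The proper power graph: the power graph with the identity removed. -/
def properPowerGraph (G : Type*) [Group G] : SimpleGraph ({g : G | g ≠ 1}) :=
  (powerGraph G).induce {g : G | g ≠ 1}

lemma s14_mem_zm {n : ℕ} (x y : ZMod n) : x ∈ AddSubgroup.zmultiples y ↔ y ∣ x := by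
  rw [AddSubgroup.mem_zmultiples_iff]
  constructor
  · rintro ⟨k, rfl⟩
    exact ⟨k, by rw [zsmul_eq_mul, mul_comm]⟩
  · rintro ⟨c, rfl⟩
    obtain ⟨k, rfl⟩ := ZMod.intCast_surjective c
    exact ⟨k, by rw [zsmul_eq_mul, mul_comm]⟩

lemma s14_adj {n : ℕ} (x y : ZMod n) :
    (powerGraphZ n).Adj x y ↔ x ≠ y ∧ (y ∣ x ∨ x ∣ y) := by
  simp only [powerGraphZ, s14_mem_zm]

lemma s14_top {n : ℕ} (x : ZMod n) : AddSubgroup.zmultiples x = ⊤ ↔ IsUnit x := by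
  rw [isUnit_iff_dvd_one, ← s14_mem_zm]
  constructor
  · intro h; rw [h]; trivial
  · intro h
    rw [eq_top_iff]
    intro y _
    rw [s14_mem_zm] at h ⊢
    exact h.trans (one_dvd y)

lemma s14_dvd_cast {n : ℕ} (g m : ℕ) (hg : g ∣ n) : (g : ZMod n) ∣ (m : ZMod n) ↔ g ∣ m := by
  constructor
  · rintro ⟨c, hc⟩
    obtain ⟨k, rfl⟩ := ZMod.intCast_surjective c
    have : ((m : ℤ) : ZMod n) = ((g * k : ℤ) : ZMod n) := by push_cast; exact hc
    rw [ZMod.intCast_eq_intCast_iff_dvd_sub] at this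
    have h1 : (g : ℤ) ∣ g * k - m := (Int.natCast_dvd_natCast.2 hg).trans this
    have h2 : (g : ℤ) ∣ m := (dvd_sub_right (dvd_mul_right _ _)).1 h1
    exact_mod_cast h2
  · exact fun h => Nat.cast_dvd_cast h

lemma s14_gcd_dvd {n : ℕ} [NeZero n] (x : ZMod n) : x ∣ ((Nat.gcd x.val n : ℕ) : ZMod n) := by
  have h := Nat.gcd_eq_gcd_ab x.val n
  refine ⟨((Nat.gcdA x.val n : ℤ) : ZMod n), ?_⟩
  have h2 := congrArg (Int.cast : ℤ → ZMod n) h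
  push_cast at h2
  rw [h2]
  simp

lemma s14_gcd_dvd' {n : ℕ} [NeZero n] (x : ZMod n) : ((Nat.gcd x.val n : ℕ) : ZMod n) ∣ x := by
  conv_rhs => rw [← ZMod.natCast_zmod_val x]
  exact Nat.cast_dvd_cast (Nat.gcd_dvd_left _ _)

lemma s14_val {n : ℕ} [NeZero n] (g : ℕ) (hg : g ∣ n) (x : ZMod n) :
    (g : ZMod n) ∣ x ↔ g ∣ x.val := by
  conv_lhs => rw [← ZMod.natCast_zmod_val x]
  exact s14_dvd_cast g _ hg

structure S14 (n p q α β : ℕ) : Prop where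
  hp : p.Prime
  hq : q.Prime
  hpq : p ≠ q
  hα : 1 ≤ α
  hβ : 1 ≤ β
  hn : n = p ^ α * q ^ β

namespace S14
variable {n p q α β : ℕ}

lemma symm (h : S14 n p q α β) : S14 n q p β α :=
  ⟨h.hq, h.hp, h.hpq.symm, h.hβ, h.hα, by rw [h.hn, mul_comm]⟩

lemma ne (h : S14 n p q α β) : n ≠ 0 := by
  rw [h.hn]; exact mul_ne_zero (pow_ne_zero _ h.hp.ne_zero) (pow_ne_zero _ h.hq.ne_zero)

lemma pdvd (h : S14 n p q α β) : p ∣ n := by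
  rw [h.hn]; exact (dvd_pow_self p (by have := h.hα; omega)).mul_right _

lemma qdvd (h : S14 n p q α β) : q ∣ n := h.symm.pdvd

lemma cop (h : S14 n p q α β) : p.Coprime q := (Nat.coprime_primes h.hp h.hq).2 h.hpq

lemma pqdvd (h : S14 n p q α β) : p * q ∣ n := h.cop.mul_dvd_of_dvd_of_dvd h.pdvd h.qdvd

lemma neq (h : S14 n p q α β) : n = p * q * (p ^ (α - 1) * q ^ (β - 1)) := by
  obtain ⟨a, rfl⟩ : ∃ a, α = a + 1 := ⟨α - 1, by have := h.hα; omega⟩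
  obtain ⟨b, rfl⟩ : ∃ a, β = a + 1 := ⟨β - 1, by have := h.hβ; omega⟩
  rw [h.hn]; simp; ring

lemma nonunit (h : S14 n p q α β) (x : ZMod n) : ¬ IsUnit x ↔ (p : ZMod n) ∣ x ∨ (q : ZMod n) ∣ x := by
  have : NeZero n := ⟨h.ne⟩
  rw [s14_val p h.pdvd, s14_val q h.qdvd]
  have : IsUnit x ↔ x.val.Coprime n := by
    conv_lhs => rw [← ZMod.natCast_zmod_val x]
    exact ZMod.isUnit_iff_coprime _ _
  rw [this]
  generalize x.val = m
  rw [h.hn, Nat.coprime_mul_iff_right, Nat.coprime_pow_right_iff (by have := h.hα; omega),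
    Nat.coprime_pow_right_iff (by have := h.hβ; omega), Nat.coprime_comm,
    h.hp.coprime_iff_not_dvd, Nat.coprime_comm, h.hq.coprime_iff_not_dvd]
  tauto

lemma pq_iff (h : S14 n p q α β) (x : ZMod n) :
    ((p * q : ℕ) : ZMod n) ∣ x ↔ (p : ZMod n) ∣ x ∧ (q : ZMod n) ∣ x := by
  have : NeZero n := ⟨h.ne⟩
  rw [s14_val p h.pdvd, s14_val q h.qdvd, s14_val _ h.pqdvd]
  exact ⟨fun k => ⟨(dvd_mul_right _ _).trans k, (dvd_mul_left _ _).trans k⟩,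
    fun k => h.cop.mul_dvd_of_dvd_of_dvd k.1 k.2⟩

lemma gcd_form (h : S14 n p q α β) (x : ZMod n) (hx : ¬ (p : ZMod n) ∣ x) :
    ∃ k ≤ β, Nat.gcd x.val n = q ^ k := by
  have : NeZero n := ⟨h.ne⟩
  rw [s14_val p h.pdvd] at hx
  apply (Nat.dvd_prime_pow h.hq).1
  have h1 : Nat.gcd x.val n ∣ p ^ α * q ^ β := by rw [← h.hn]; exact Nat.gcd_dvd_right _ _
  refine Nat.Coprime.dvd_of_dvd_mul_left ?_ h1
  apply Nat.Coprime.pow_right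
  rw [Nat.coprime_comm, h.hp.coprime_iff_not_dvd]
  exact fun k => hx (k.trans (Nat.gcd_dvd_left _ _))

lemma dvd_qpow (h : S14 n p q α β) (x : ZMod n) (hx : ¬ (p : ZMod n) ∣ x) :
    x ∣ (q : ZMod n) ^ β := by
  have : NeZero n := ⟨h.ne⟩
  obtain ⟨k, hk, e⟩ := h.gcd_form x hx
  have := s14_gcd_dvd x
  rw [e] at this
  push_cast at this
  exact this.trans (pow_dvd_pow _ hk)

/-- elements outside `<p>` form a chain; hence a minimum exists -/
lemma exists_min (h : S14 n p q α β) (A : Set (ZMod n)) (hA : ∀ x ∈ A, ¬ (p : ZMod n) ∣ x)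
    (hne : A.Nonempty) : ∃ b ∈ A, ∀ x ∈ A, b ∣ x := by
  have : NeZero n := ⟨h.ne⟩
  obtain ⟨b, hb, hmin⟩ := Set.exists_min_image A (fun x => Nat.gcd x.val n) (Set.toFinite A) hne
  refine ⟨b, hb, fun x hx => ?_⟩
  obtain ⟨k, _, e⟩ := h.gcd_form b (hA b hb)
  obtain ⟨l, _, e'⟩ := h.gcd_form x (hA x hx)
  have h1 := hmin x hx
  simp only [e, e'] at h1
  have h2 : k ≤ l := (Nat.pow_le_pow_iff_right h.hq.one_lt).1 h1
  refine (s14_gcd_dvd b).trans (dvd_trans ?_ (s14_gcd_dvd' x))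
  rw [e, e']
  exact Nat.cast_dvd_cast (pow_dvd_pow _ h2)

lemma dvd_p (h : S14 n p q α β) (x : ZMod n) (hx : ¬ (q : ZMod n) ∣ x)
    (hx2 : α = 1 ∨ ¬ (p : ZMod n) ^ 2 ∣ x) : x ∣ (p : ZMod n) := by
  have : NeZero n := ⟨h.ne⟩
  obtain ⟨k, hk, e⟩ := h.symm.gcd_form x hx
  have h1 := s14_gcd_dvd x
  have h2 := s14_gcd_dvd' x
  rw [e] at h1 h2
  push_cast at h1 h2
  have hk1 : k ≤ 1 := by
    rcases hx2 with rfl | hx2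
    · exact hk
    · by_contra hc
      exact hx2 ((pow_dvd_pow _ (by omega)).trans h2)
  exact h1.trans (by simpa using pow_dvd_pow (p : ZMod n) hk1)

lemma q_ndvd (h : S14 n p q α β) (m : ℕ) (hm : ¬ q ∣ m) : ¬ (q : ZMod n) ∣ (m : ZMod n) := by
  rwa [s14_dvd_cast q m h.qdvd]

lemma q_ndvd_ppow (h : S14 n p q α β) (k : ℕ) : ¬ (q : ZMod n) ∣ (p : ZMod n) ^ k := by
  have := h.q_ndvd (p ^ k) (fun hh => h.hpq ((Nat.prime_dvd_prime_iff_eq h.hq h.hp).1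
    (h.hq.dvd_of_dvd_pow hh)).symm)
  exact_mod_cast this

lemma q_ndvd_two (h : S14 n p q α β) (h3 : 3 ≤ q) (k : ℕ) :
    ¬ (q : ZMod n) ∣ 2 * (p : ZMod n) ^ k := by
  have := h.q_ndvd (2 * p ^ k) (fun hh => by
    rcases h.hq.dvd_mul.1 hh with hh | hh
    · have := Nat.le_of_dvd (by norm_num) hh
      omega
    · exact h.hpq ((Nat.prime_dvd_prime_iff_eq h.hq h.hp).1 (h.hq.dvd_of_dvd_pow hh)).symm)
  exact_mod_cast this

/-- The set `<pq>`. -/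
def D (n p q : ℕ) : Set (ZMod n) := {x | (p : ZMod n) ∣ x ∧ (q : ZMod n) ∣ x}

lemma D_eq (h : S14 n p q α β) :
    (AddSubgroup.zmultiples (((p * q : ℕ) : ZMod n)) : Set (ZMod n)) = D n p q := by
  ext x
  rw [SetLike.mem_coe, s14_mem_zm, h.pq_iff]; rfl

lemma D_card (h : S14 n p q α β) : (D n p q).ncard = p ^ (α - 1) * q ^ (β - 1) := by
  rw [← h.D_eq, ← Nat.card_coe_set_eq]
  have : Nat.card (AddSubgroup.zmultiples (((p * q : ℕ) : ZMod n))) = p ^ (α - 1) * q ^ (β - 1) := by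
    rw [Nat.card_zmultiples, ZMod.addOrderOf_coe _ h.ne, Nat.gcd_eq_right h.pqdvd]
    conv_lhs => rw [h.neq]
    rw [Nat.mul_div_cancel_left _ (Nat.mul_pos h.hp.pos h.hq.pos)]
  exact this

lemma units_card (h : S14 n p q α β) : {x : ZMod n | IsUnit x}.ncard = Nat.totient n := by
  have : NeZero n := ⟨h.ne⟩
  have : {x : ZMod n | IsUnit x} = (Units.val : (ZMod n)ˣ → ZMod n) '' Set.univ := by
    ext x; simp [IsUnit]
  rw [this, Set.ncard_image_of_injective _ Units.val_injective, Set.ncard_univ,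
    Nat.card_eq_fintype_card, ZMod.card_units_eq_totient]

lemma P_card (h : S14 n p q α β) (h3 : 3 ≤ q) :
    (D n p q).ncard ≤ {x : ZMod n | (p : ZMod n) ∣ x ∧ x ∣ (p : ZMod n)}.ncard := by
  classical
  have : NeZero n := ⟨h.ne⟩
  have hpa : (p : ZMod n) ∣ (p : ZMod n) ^ α := dvd_pow_self _ (by have := h.hα; omega)
  refine Set.ncard_le_ncard_of_injOn
    (fun y => if α = 1 ∨ ¬ (p : ZMod n) ^ 2 ∣ y then y + (p : ZMod n) ^ α
      else y + p * q + 2 * (p : ZMod n) ^ α) ?_ ?_ (Set.toFinite _)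
  · rintro y ⟨hy1, hy2⟩
    by_cases hc : α = 1 ∨ ¬ (p : ZMod n) ^ 2 ∣ y
    · simp only [hc, if_true]
      refine ⟨dvd_add hy1 hpa, h.dvd_p _ ?_ ?_⟩
      · rw [dvd_add_right hy2]; exact h.q_ndvd_ppow α
      · rcases hc with hc | hc
        · exact Or.inl hc
        · by_cases h1 : α = 1
          · exact Or.inl h1
          · right
            rwa [dvd_add_left (pow_dvd_pow _ (by have := h.hα; omega))]
    · simp only [hc, if_false]
      push Not at hc
      refine ⟨dvd_add (dvd_add hy1 (dvd_mul_right _ _)) (hpa.mul_left _), h.dvd_p _ ?_ ?_⟩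
      · rw [dvd_add_right (dvd_add hy2 (dvd_mul_left _ _))]; exact h.q_ndvd_two h3 α
      · right
        have ha := h.hα
        rw [dvd_add_left ((pow_dvd_pow _ (by omega)).mul_left _), dvd_add_right hc.2]
        have h2 : p ^ 2 ∣ n := by
          rw [h.hn]; exact (pow_dvd_pow _ (by omega)).mul_right _
        have := (s14_dvd_cast (p ^ 2) (p * q) h2).not.2 (fun hh => by
          rw [pow_two] at hh
          have := Nat.dvd_of_mul_dvd_mul_left h.hp.pos hh
          exact h.hpq ((Nat.prime_dvd_prime_iff_eq h.hp h.hq).1 this))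
        exact_mod_cast this
  · have cross : ∀ y ∈ D n p q, ∀ z ∈ D n p q,
        y + (p : ZMod n) ^ α ≠ z + p * q + 2 * (p : ZMod n) ^ α := by
      intro y hy z hz he
      apply h.q_ndvd_ppow α
      have : (p : ZMod n) ^ α = y - z - p * q := by linear_combination -he
      rw [this]
      exact dvd_sub (dvd_sub hy.2 hz.2) (dvd_mul_left _ _)
    intro y hy z hz he
    simp only at he
    split_ifs at he
    · exact add_right_cancel he
    · exact (cross y hy z hz he).elim
    · exact (cross z hz y hy he.symm).elim
    · exact add_right_cancel (add_right_cancel he)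

lemma inj_card (h : S14 n p q α β) (T : Set (ZMod n)) (R : ZMod n → Prop)
    (h1 : ∀ y ∈ D n p q, R y → y ∈ T)
    (h2 : ∀ y ∈ D n p q, ¬ R y → y + (q : ZMod n) ^ β ∈ T) : (D n p q).ncard ≤ T.ncard := by
  classical
  have : NeZero n := ⟨h.ne⟩
  refine Set.ncard_le_ncard_of_injOn (fun y => if R y then y else y + (q : ZMod n) ^ β) ?_ ?_
    (Set.toFinite _)
  · intro y hy
    by_cases hc : R y
    · simpa only [hc, if_true] using h1 y hy hc
    · simpa only [hc, if_false] using h2 y hy hc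
  · have cross : ∀ y ∈ D n p q, ∀ z ∈ D n p q, y ≠ z + (q : ZMod n) ^ β := by
      intro y hy z hz he
      apply h.symm.q_ndvd_ppow β
      have : (q : ZMod n) ^ β = y - z := by linear_combination -he
      rw [this]
      exact dvd_sub hy.1 hz.1
    intro y hy z hz he
    simp only at he
    split_ifs at he
    · exact he
    · exact (cross y hy z hz he).elim
    · exact (cross z hz y hy he.symm).elim
    · exact add_right_cancel he

lemma reach {S : Set (ZMod n)} (x y : (Sᶜ : Set (ZMod n))) (hxy : x.1 ∣ y.1) :
    ((powerGraphZ n).induce Sᶜ).Reachable x y := by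
  by_cases he : x = y
  · rw [he]
  · apply SimpleGraph.Adj.reachable
    rw [SimpleGraph.induce_adj, s14_adj]
    exact ⟨fun hh => he (Subtype.ext hh), Or.inr hxy⟩

lemma precon {S : Set (ZMod n)} (z : (Sᶜ : Set (ZMod n)))
    (hz : ∀ x, ((powerGraphZ n).induce Sᶜ).Reachable z x) :
    ((powerGraphZ n).induce Sᶜ).Preconnected := fun x y => (hz x).symm.trans (hz y)

lemma key_aux (h : S14 n p q α β) (h3 : 3 ≤ q) (S : Set (ZMod n))
    (hS : ¬ ((powerGraphZ n).induce Sᶜ).Preconnected) :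
    {x : ZMod n | IsUnit x} ⊆ S ∧ (D n p q).ncard ≤ (S \ {x : ZMod n | IsUnit x}).ncard := by
  have : NeZero n := ⟨h.ne⟩
  constructor
  · intro u hu
    by_contra hc
    exact hS (precon ⟨u, hc⟩ fun x => reach _ _ (IsUnit.dvd hu))
  by_contra hlt
  have hpn : ∀ x : ZMod n, (p : ZMod n) ∣ x → ¬ IsUnit x := fun x hx => (h.nonunit x).2 (Or.inl hx)
  have hqn : ∀ x : ZMod n, (q : ZMod n) ∣ x → ¬ IsUnit x := fun x hx => (h.nonunit x).2 (Or.inr hx)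
  have hqb : (q : ZMod n) ∣ (q : ZMod n) ^ β := dvd_pow_self _ (by have := h.hβ; omega)
  -- a
  obtain ⟨a, ⟨ha1, ha2⟩, haS⟩ : ∃ a, ((p : ZMod n) ∣ a ∧ a ∣ (p : ZMod n)) ∧ a ∉ S := by
    by_contra hc
    push Not at hc
    exact hlt ((h.P_card h3).trans (Set.ncard_le_ncard
      (fun x hx => ⟨hc x hx, hpn x hx.1⟩) (Set.toFinite _)))
  -- b
  obtain ⟨b, ⟨hbS, hb1, hb2⟩, hb⟩ := h.exists_min
    {x | x ∉ S ∧ (q : ZMod n) ∣ x ∧ ¬ (p : ZMod n) ∣ x} (fun x hx => hx.2.2) (by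
      by_contra hc
      rw [Set.not_nonempty_iff_eq_empty, Set.eq_empty_iff_forall_notMem] at hc
      refine hlt (h.inj_card _ (fun _ => False) (fun _ _ k => k.elim) (fun y hy _ => ?_))
      refine ⟨?_, hqn _ (dvd_add hy.2 hqb)⟩
      by_contra hyS
      refine hc _ ⟨hyS, dvd_add hy.2 hqb, ?_⟩
      rw [dvd_add_right hy.1]
      exact h.symm.q_ndvd_ppow β)
  -- e
  obtain ⟨e, he1, he2, heS⟩ : ∃ e, e ∈ D n p q ∧ b ∣ e ∧ e ∉ S := by
    by_contra hc
    push Not at hc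
    refine hlt (h.inj_card _ (fun y => b ∣ y) (fun y hy hby => ⟨hc y hy hby, hpn _ hy.1⟩)
      (fun y hy hby => ?_))
    refine ⟨?_, hqn _ (dvd_add hy.2 hqb)⟩
    by_contra hyS
    have := hb _ ⟨hyS, dvd_add hy.2 hqb, by
      rw [dvd_add_right hy.1]
      exact h.symm.q_ndvd_ppow β⟩
    rw [dvd_add_left (h.dvd_qpow b hb2)] at this
    exact hby this
  refine hS (precon ⟨e, heS⟩ fun x => ?_)
  have hea := (reach (⟨a, haS⟩ : (Sᶜ : Set (ZMod n))) ⟨e, heS⟩ (ha2.trans he1.1)).symm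
  have heb := (reach (⟨b, hbS⟩ : (Sᶜ : Set (ZMod n))) ⟨e, heS⟩ he2).symm
  by_cases hxp : (p : ZMod n) ∣ x.1
  · exact hea.trans (reach _ _ (ha2.trans hxp))
  by_cases hxq : (q : ZMod n) ∣ x.1
  · exact heb.trans (reach _ _ (hb _ ⟨x.2, hxq, hxp⟩))
  have hu : IsUnit x.1 := by
    by_contra hc
    rcases (h.nonunit _).1 hc with hc | hc <;> contradiction
  exact (reach _ _ hu.dvd).symm

lemma key (h : S14 n p q α β) (S : Set (ZMod n))
    (hS : ¬ ((powerGraphZ n).induce Sᶜ).Preconnected) :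
    {x : ZMod n | IsUnit x} ⊆ S ∧ (D n p q).ncard ≤ (S \ {x : ZMod n | IsUnit x}).ncard := by
  rcases le_or_gt 3 q with h3 | h3
  · exact h.key_aux h3 S hS
  · have h2 := h.hp.two_le
    have h2' := h.hq.two_le
    have := h.hpq
    have hc : D n p q = D n q p := by
      ext x; exact and_comm
    rw [hc]
    exact h.symm.key_aux (by omega) S hS

lemma key' (h : S14 n p q α β) (S : Set (ZMod n))
    (hS : ¬ ((powerGraphZ n).induce Sᶜ).Preconnected) :
    Nat.totient n + p ^ (α - 1) * q ^ (β - 1) ≤ S.ncard := by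
  have : NeZero n := ⟨h.ne⟩
  obtain ⟨h1, h2⟩ := h.key S hS
  have := Set.ncard_sdiff_add_ncard_of_subset h1 (Set.toFinite _)
  rw [h.units_card] at this
  rw [h.D_card] at h2
  omega

lemma zero_mem (S : Set (ZMod n))
    (hS : ¬ ((powerGraphZ n).induce Sᶜ).Preconnected) : (0 : ZMod n) ∈ S := by
  by_contra hc
  exact hS (precon ⟨0, hc⟩ fun x => (reach _ _ (dvd_zero _)).symm)

lemma p_nD (h : S14 n p q α β) : (p : ZMod n) ∉ D n p q := fun hh => by
  have := h.q_ndvd_ppow 1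
  rw [pow_one] at this
  exact this hh.2

lemma q_nD (h : S14 n p q α β) : (q : ZMod n) ∉ D n p q := fun hh => by
  have := h.symm.q_ndvd_ppow 1
  rw [pow_one] at this
  exact this hh.1

lemma discon (h : S14 n p q α β) (S : Set (ZMod n)) (hS : S = {x : ZMod n | IsUnit x} ∪ D n p q) :
    ¬ ((powerGraphZ n).induce Sᶜ).Preconnected := by
  intro hc
  have hpS : (p : ZMod n) ∈ Sᶜ := by
    rw [hS]; rintro (hh | hh)
    · exact (h.nonunit _).2 (Or.inl dvd_rfl) hh
    · exact h.p_nD hh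
  have hqS : (q : ZMod n) ∈ Sᶜ := by
    rw [hS]; rintro (hh | hh)
    · exact (h.nonunit _).2 (Or.inr dvd_rfl) hh
    · exact h.q_nD hh
  obtain ⟨w⟩ := hc ⟨p, hpS⟩ ⟨q, hqS⟩
  have inv : ∀ (x y : (Sᶜ : Set (ZMod n))), ((powerGraphZ n).induce Sᶜ).Walk x y →
      (p : ZMod n) ∣ x.1 → (p : ZMod n) ∣ y.1 := by
    intro x y w
    induction w with
    | nil => exact id
    | @cons u v w hadj _ ih =>
      intro hu
      apply ih
      rw [SimpleGraph.induce_adj, s14_adj] at hadj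
      rcases hadj.2 with hd | hd
      · have hv : ¬ IsUnit v.1 := fun hh => v.2 (hS.symm.subset (Or.inl hh))
        rcases (h.nonunit _).1 hv with hv | hv
        · exact hv
        · exact (u.2 (hS.symm.subset (Or.inr ⟨hu, hv.trans hd⟩))).elim
      · exact hu.trans hd
  exact h.q_nD ⟨inv _ _ w dvd_rfl, dvd_rfl⟩

lemma sep_card (h : S14 n p q α β) : ({x : ZMod n | IsUnit x} ∪ D n p q).ncard =
    Nat.totient n + p ^ (α - 1) * q ^ (β - 1) := by
  have : NeZero n := ⟨h.ne⟩
  rw [Set.ncard_union_eq _ (Set.toFinite _) (Set.toFinite _), h.units_card, h.D_card]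
  rw [Set.disjoint_left]
  exact fun x hx hD => (h.nonunit x).2 (Or.inl hD.1) hx

lemma kappa_eq (h : S14 n p q α β) :
    kappa (powerGraphZ n) = Nat.totient n + p ^ (α - 1) * q ^ (β - 1) := by
  have : NeZero n := ⟨h.ne⟩
  apply le_antisymm
  · exact Nat.sInf_le ⟨_, h.sep_card, Or.inl (h.discon _ rfl)⟩
  · refine le_csInf ⟨_, _, h.sep_card, Or.inl (h.discon _ rfl)⟩ ?_
    rintro k ⟨S, rfl, hS | hS⟩
    · exact h.key' S hS
    · have h1 := Set.ncard_add_ncard_compl S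
      have h2 := Set.ncard_add_ncard_compl ({x : ZMod n | IsUnit x} ∪ D n p q)
      rw [h.sep_card] at h2
      have h3 : 0 < (({x : ZMod n | IsUnit x} ∪ D n p q)ᶜ).ncard := by
        rw [Set.ncard_pos]
        refine ⟨(p : ZMod n), ?_⟩
        rintro (hh | hh)
        · exact (h.nonunit _).2 (Or.inl dvd_rfl) hh
        · exact h.p_nD hh
      omega

lemma mem_tilde (x : ZMod n) : x ∈ tildeVerts n ↔ ¬ IsUnit x ∧ x ≠ 0 := by
  simp only [tildeVerts, genSet, Set.mem_compl_iff, Set.mem_union, Set.mem_ofPred_eq,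
    s14_top, Set.mem_singleton_iff, not_or, ne_eq]

/-- Nested deletion. -/
def tIso (T : Set (tildeVerts n)) : (tildeGraph n).induce Tᶜ ≃g
    (powerGraphZ n).induce (genSet n ∪ Subtype.val '' T)ᶜ where
  toFun x := ⟨x.1.1, by
    rintro (hh | ⟨y, hy, e⟩)
    · exact x.1.2 hh
    · exact x.2 (by rwa [← Subtype.ext e])⟩
  invFun x := ⟨⟨x.1, fun hh => x.2 (Or.inl hh)⟩, fun hh => x.2 (Or.inr ⟨_, hh, rfl⟩)⟩
  left_inv _ := rfl
  right_inv _ := rfl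
  map_rel_iff' := Iff.rfl

lemma genSet_eq : genSet n = {x : ZMod n | IsUnit x} ∪ {0} := by
  ext x; simp [genSet, s14_top]

lemma lb (h : S14 n p q α β) (T : Set (tildeVerts n))
    (hT : ¬ ((tildeGraph n).induce Tᶜ).Preconnected) :
    p ^ (α - 1) * q ^ (β - 1) ≤ T.ncard + 1 := by
  have : NeZero n := ⟨h.ne⟩
  rw [(tIso T).preconnected_iff] at hT
  have h1 := h.key' _ hT
  have h2 := Set.ncard_union_le (genSet n) (Subtype.val '' T)
  rw [Set.ncard_image_of_injective _ Subtype.val_injective] at h2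
  have h3 := Set.ncard_union_le {x : ZMod n | IsUnit x} {0}
  rw [← genSet_eq, h.units_card, Set.ncard_singleton] at h3
  omega

lemma min_sep (h : S14 n p q α β) (hne : n ≠ p * q) : IsMinimumSepSet (tildeGraph n)
        (Subtype.val ⁻¹' (D n p q \ {0})) := by
  have : NeZero n := ⟨h.ne⟩
  have hp1 : (p : ZMod n) ∈ tildeVerts n := (mem_tilde _).2
    ⟨(h.nonunit _).2 (Or.inl dvd_rfl), fun hh => h.p_nD ⟨dvd_rfl, by rw [hh]; exact dvd_zero _⟩⟩
  have himg : Subtype.val '' (Subtype.val ⁻¹' (D n p q \ {0}) : Set (tildeVerts n)) =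
      D n p q \ {0} := by
    rw [Subtype.image_preimage_coe]
    apply Set.inter_eq_right.2
    rintro x ⟨hx, hx0⟩
    exact (mem_tilde _).2 ⟨(h.nonunit _).2 (Or.inl hx.1), hx0⟩
  have h0 : (0 : ZMod n) ∈ D n p q := ⟨dvd_zero _, dvd_zero _⟩
  have hcard : (Subtype.val ⁻¹' (D n p q \ {0}) : Set (tildeVerts n)).ncard + 1 =
      p ^ (α - 1) * q ^ (β - 1) := by
    rw [← Set.ncard_image_of_injective _ Subtype.val_injective, himg, ← h.D_card]
    exact Set.ncard_sdiff_singleton_add_one h0 (Set.toFinite _)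
  constructor
  · have hA : numComponents (tildeGraph n) ≤ 1 := by
      have hpc : (tildeGraph n).Preconnected := by
        by_contra hc
        have hc' : ¬ ((tildeGraph n).induce (∅ : Set (tildeVerts n))ᶜ).Preconnected := by
          rw [Set.compl_empty, (SimpleGraph.induceUnivIso _).preconnected_iff]
          exact hc
        have h1 := h.lb ∅ hc'
        rw [Set.ncard_empty] at h1
        apply hne
        have hpos : 0 < p ^ (α - 1) * q ^ (β - 1) :=
          Nat.mul_pos (pow_pos h.hp.pos _) (pow_pos h.hq.pos _)
        have h2 := h.neq
        rw [show p ^ (α - 1) * q ^ (β - 1) = 1 by omega, mul_one] at h2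
        exact h2
      have := hpc.subsingleton_connectedComponent
      exact Finite.card_le_one_iff_subsingleton.2 this
    have hB : 1 < numComponents ((tildeGraph n).induce
        (Subtype.val ⁻¹' (D n p q \ {0}) : Set (tildeVerts n))ᶜ) := by
      by_contra hc
      push Not at hc
      have hs := Finite.card_le_one_iff_subsingleton.1 hc
      have hpc : ((tildeGraph n).induce
        (Subtype.val ⁻¹' (D n p q \ {0}) : Set (tildeVerts n))ᶜ).Preconnected := fun x y =>
          SimpleGraph.ConnectedComponent.exact (Subsingleton.elim _ _)
      rw [(tIso _).preconnected_iff] at hpc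
      refine h.discon _ ?_ hpc
      rw [himg, genSet_eq, Set.union_assoc, Set.union_sdiff_self,
        Set.singleton_union, Set.insert_eq_of_mem h0]
    exact hA.trans_lt hB
  · intro S hS
    have hA : 1 ≤ numComponents (tildeGraph n) := by
      have : Nonempty (tildeGraph n).ConnectedComponent :=
        ⟨(tildeGraph n).connectedComponentMk ⟨_, hp1⟩⟩
      exact Nat.card_pos
    have := h.lb S (fun hpc => by
      have := hpc.subsingleton_connectedComponent
      have hB : numComponents ((tildeGraph n).induce Sᶜ) ≤ 1 :=
        Finite.card_le_one_iff_subsingleton.2 this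
      have : numComponents (tildeGraph n) < numComponents ((tildeGraph n).induce Sᶜ) := hS
      omega)
    omega

end S14

/-- If `n = p^α q^β` with `p ≠ q` primes and `α, β ≥ 1`, then
`κ(𝒢(ℤ_n)) = φ(n) + p^{α−1} q^{β−1}`; moreover if `n ≠ pq` then
`⟨\overline{pq}⟩ − {0̄}` is a minimum separating set of `𝒢̃(ℤ_n)`. -/
theorem stmt14 (n p q α β : ℕ) (hp : p.Prime) (hq : q.Prime) (hpq : p ≠ q)
    (hα : 1 ≤ α) (hβ : 1 ≤ β) (hn : n = p ^ α * q ^ β) :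
    kappa (powerGraphZ n) = Nat.totient n + p ^ (α - 1) * q ^ (β - 1) ∧
    (n ≠ p * q →
      IsMinimumSepSet (tildeGraph n)
        (Subtype.val ⁻¹'
          (((AddSubgroup.zmultiples (((p * q : ℕ) : ZMod n)) : Set (ZMod n)) \ {0})))) := by
  have h : S14 n p q α β := ⟨hp, hq, hpq, hα, hβ, hn⟩
  refine ⟨h.kappa_eq, fun hne => ?_⟩
  rw [h.D_eq]
  exact h.min_sep hne
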